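/- arXiv:2512.20045 — 2 statements merged into one kernel-verified Lean document; each statement's English description precedes it below -/
import Mathlib

section
/- (Ritt–Raudenbush basis theorem for the free differential algebra on finitely many generators.) Every ascending chain I_0 ⊆ I_1 ⊆ I_2 ⊆ ⋯ of radical differential ideals of B eventually stabilizes: there exists n such that I_s = I_n for all s ≥ n. Equivalently, there is no infinite strictly increasing chain of radical differential ideals of B. -/
noncomputable section

/-- The free differential `ℂ`-algebra on `N` differential generators:
the polynomial algebra in the variables `y(i,α)`, `i ∈ Fin N`, `α ∈ ℕ`. -/
abbrev B (N : ℕ) : Type := MvPolynomial (Fin N × ℕ) ℂ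

/-- The derivation `∂` with `∂ y(i,α) = y(i,α+1)`. -/
noncomputable def derB (N : ℕ) : Derivation ℂ (B N) (B N) :=
  MvPolynomial.mkDerivation ℂ (fun p => MvPolynomial.X (p.1, p.2 + 1))

section RadicalDifferentialIdeal

variable {k A : Type*} [CommRing k] [CommRing A] [Algebra k A] {D : Derivation k A A}

/-- A radical ideal stable under the derivation `D`. -/
structure IsRadDiff (D : Derivation k A A) (I : Ideal A) : Prop where
  isRadical : I.IsRadical
  der_mem : ∀ a ∈ I, D a ∈ I

/-- The smallest radical differential ideal containing a set. -/
def radDiffSpan (D : Derivation k A A) (S : Set A) : Ideal A :=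
  sInf {I | S ⊆ I ∧ IsRadDiff D I}

theorem radDiffSpan_le {S : Set A} {I : Ideal A} (hI : IsRadDiff D I) (h : S ⊆ I) :
    radDiffSpan D S ≤ I :=
  sInf_le ⟨h, hI⟩

theorem subset_radDiffSpan (S : Set A) : S ⊆ radDiffSpan D S := by
  intro x hx
  simp only [radDiffSpan, SetLike.mem_coe, Submodule.mem_sInf]
  exact fun I hI => hI.1 hx

theorem isRadDiff_radDiffSpan (S : Set A) : IsRadDiff D (radDiffSpan D S) where
  isRadical := by
    rintro x ⟨n, hn⟩
    simp only [radDiffSpan, Submodule.mem_sInf] at hn ⊢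
    exact fun I hI => hI.2.isRadical ⟨n, hn I hI⟩
  der_mem := by
    intro x hx
    simp only [radDiffSpan, Submodule.mem_sInf] at hx ⊢
    exact fun I hI => hI.2.der_mem x (hx I hI)

theorem radDiffSpan_mono {S T : Set A} (h : S ⊆ T) : radDiffSpan D S ≤ radDiffSpan D T :=
  radDiffSpan_le (isRadDiff_radDiffSpan T) (h.trans (subset_radDiffSpan T))

/-- The ideal of all `x` with `a * x ∈ K`. -/
def colonElem (K : Ideal A) (a : A) : Ideal A :=
  Submodule.comap (LinearMap.mulLeft A a) K

theorem mem_colonElem {K : Ideal A} {a x : A} : x ∈ colonElem K a ↔ a * x ∈ K := Iff.rfl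

theorem IsRadDiff.mem_of_sq_mem {K : Ideal A} (hK : IsRadDiff D K) {x : A} (h : x * x ∈ K) :
    x ∈ K :=
  hK.isRadical ⟨2, by rwa [pow_two]⟩

theorem IsRadDiff.colonElem {K : Ideal A} (hK : IsRadDiff D K) (a : A) :
    IsRadDiff D (colonElem K a) where
  isRadical := by
    rintro x ⟨n, hn⟩
    refine hK.isRadical ⟨n + 1, ?_⟩
    have : (a * x) ^ (n + 1) = a ^ n * x * (a * x ^ n) := by ring
    change (a * x) ^ (n + 1) ∈ K
    rw [this]
    exact K.mul_mem_left _ hn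
  der_mem := by
    intro x hx
    rw [mem_colonElem] at hx ⊢
    apply hK.mem_of_sq_mem
    have h1 := K.mul_mem_left (a * D x) (hK.der_mem _ hx)
    have h2 := K.mul_mem_left (D a * D x) hx
    have : a * D x * (a * D x) = a * D x * D (a * x) - D a * D x * (a * x) := by
      simp only [Derivation.leibniz, smul_eq_mul]
      ring
    rw [this]
    exact K.sub_mem h1 h2

theorem mul_mem_of_mem_radDiffSpan {S T : Set A} {K : Ideal A} (hK : IsRadDiff D K)
    (h : ∀ s ∈ S, ∀ t ∈ T, s * t ∈ K) {x y : A} (hx : x ∈ radDiffSpan D S)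
    (hy : y ∈ radDiffSpan D T) : x * y ∈ K := by
  have h1 : ∀ s ∈ S, s * y ∈ K := fun s hs =>
    radDiffSpan_le (hK.colonElem s) (fun t ht => h s hs t ht) hy
  have h2 : x ∈ colonElem K y := radDiffSpan_le (hK.colonElem y)
    (fun s hs => by
      rw [SetLike.mem_coe, mem_colonElem, mul_comm]
      exact h1 s hs) hx
  rw [mul_comm]
  exact h2

theorem exists_finite_of_mem_radDiffSpan {S : Set A} {x : A} (hx : x ∈ radDiffSpan D S) :
    ∃ F ⊆ S, F.Finite ∧ x ∈ radDiffSpan D F := by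
  let K : Ideal A :=
    { carrier := {x | ∃ F ⊆ S, F.Finite ∧ x ∈ radDiffSpan D F}
      zero_mem' := ⟨∅, by simp, Set.finite_empty, zero_mem _⟩
      add_mem' := by
        rintro a b ⟨F, hFS, hF, ha⟩ ⟨G, hGS, hG, hb⟩
        exact ⟨F ∪ G, Set.union_subset hFS hGS, hF.union hG,
          add_mem (radDiffSpan_mono Set.subset_union_left ha)
            (radDiffSpan_mono Set.subset_union_right hb)⟩
      smul_mem' := by
        rintro c a ⟨F, hFS, hF, ha⟩
        exact ⟨F, hFS, hF, Ideal.mul_mem_left _ c ha⟩ }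
  have hK : IsRadDiff D K :=
    { isRadical := by
        rintro a ⟨n, F, hFS, hF, ha⟩
        exact ⟨F, hFS, hF, (isRadDiff_radDiffSpan F).isRadical ⟨n, ha⟩⟩
      der_mem := by
        rintro a ⟨F, hFS, hF, ha⟩
        exact ⟨F, hFS, hF, (isRadDiff_radDiffSpan F).der_mem a ha⟩ }
  exact radDiffSpan_le hK (fun s hs => ⟨{s}, by simpa using hs, Set.finite_singleton s,
    subset_radDiffSpan _ rfl⟩) hx

theorem exists_finite_of_finite_subset_radDiffSpan {S G : Set A} (hG : G.Finite)
    (h : G ⊆ radDiffSpan D S) : ∃ F ⊆ S, F.Finite ∧ G ⊆ radDiffSpan D F := by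
  choose! F hFS hF hx using fun x (hx : x ∈ G) => exists_finite_of_mem_radDiffSpan (h hx)
  refine ⟨⋃ x ∈ G, F x, Set.iUnion₂_subset hFS, hG.biUnion hF, fun x hxG => ?_⟩
  exact radDiffSpan_mono (Set.subset_biUnion_of_mem hxG) (hx x hxG)

/-- `I` is generated, as a radical differential ideal, by a finite set. -/
def IsFinGen (D : Derivation k A A) (I : Ideal A) : Prop :=
  ∃ F : Set A, F.Finite ∧ I = radDiffSpan D F

theorem IsFinGen.exists_finite_insert {I : Ideal A} {a : A}
    (h : IsFinGen D (radDiffSpan D (insert a I))) :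
    ∃ F ⊆ (I : Set A), F.Finite ∧ I ≤ radDiffSpan D (insert a F) := by
  obtain ⟨G, hG, hGI⟩ := h
  obtain ⟨F, hFS, hF, hGF⟩ := exists_finite_of_finite_subset_radDiffSpan hG
    (hGI ▸ subset_radDiffSpan (D := D) G)
  refine ⟨F ∩ I, Set.inter_subset_right, hF.inter_of_left _, ?_⟩
  have h1 : F ⊆ insert a (F ∩ (I : Set A)) := by
    intro x hx
    rcases hFS hx with h | h
    · exact Or.inl h
    · exact Or.inr ⟨hx, h⟩
  intro x hx
  have : x ∈ radDiffSpan D G := hGI ▸ subset_radDiffSpan _ (Or.inr hx)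
  exact radDiffSpan_mono h1 (radDiffSpan_le (isRadDiff_radDiffSpan F) hGF this)

theorem exists_maximal_not_isFinGen {I₀ : Ideal A} (h₀ : IsRadDiff D I₀)
    (hfg : ¬ IsFinGen D I₀) :
    ∃ I : Ideal A, Maximal (fun I => IsRadDiff D I ∧ ¬ IsFinGen D I) I := by
  suffices h : ∀ c ⊆ {I : Ideal A | IsRadDiff D I ∧ ¬ IsFinGen D I}, IsChain (· ≤ ·) c →
      ∀ y ∈ c, ∃ ub ∈ {I : Ideal A | IsRadDiff D I ∧ ¬ IsFinGen D I}, ∀ z ∈ c, z ≤ ub by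
    obtain ⟨m, -, hm⟩ := zorn_le_nonempty₀ _ h I₀ ⟨h₀, hfg⟩
    exact ⟨m, hm⟩
  intro c hc hchain y hy
  have hmem : ∀ x : A, x ∈ sSup c ↔ ∃ I ∈ c, x ∈ I := fun x =>
    Submodule.mem_sSup_of_directed ⟨y, hy⟩ hchain.directedOn
  have hsup : IsRadDiff D (sSup c) :=
    { isRadical := by
        rintro x ⟨n, hn⟩
        obtain ⟨I, hI, hx⟩ := (hmem _).1 hn
        exact (hmem _).2 ⟨I, hI, (hc hI).1.isRadical ⟨n, hx⟩⟩
      der_mem := by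
        intro x hx
        obtain ⟨I, hI, hx⟩ := (hmem _).1 hx
        exact (hmem _).2 ⟨I, hI, (hc hI).1.der_mem x hx⟩ }
  refine ⟨sSup c, ⟨hsup, ?_⟩, fun z hz => le_sSup hz⟩
  rintro ⟨F, hF, hFc⟩
  have hcov : ∀ G : Set A, G.Finite → G ⊆ F → ∃ I ∈ c, G ⊆ I := by
    intro G hG
    induction G, hG using Set.Finite.induction_on with
    | empty => exact fun _ => ⟨y, hy, by simp⟩
    | @insert a G _ _ ih =>
      intro h
      obtain ⟨I, hI, hGI⟩ := ih ((Set.subset_insert _ _).trans h)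
      have ha : a ∈ sSup c := hFc ▸ subset_radDiffSpan F (h (Set.mem_insert _ _))
      obtain ⟨J, hJ, haJ⟩ := (hmem _).1 ha
      obtain ⟨L, hL, hIL, hJL⟩ := hchain.directedOn I hI J hJ
      exact ⟨L, hL, Set.insert_subset (hJL haJ) (hGI.trans hIL)⟩
  obtain ⟨I, hI, hFI⟩ := hcov F hF subset_rfl
  refine (hc hI).2 ⟨F, hF, le_antisymm (hFc ▸ le_sSup hI) (radDiffSpan_le (hc hI).1 hFI)⟩

variable {I : Ideal A}

theorem isFinGen_insert_of_maximal
    (hI : Maximal (fun I => IsRadDiff D I ∧ ¬ IsFinGen D I) I) {a : A} (ha : a ∉ I) :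
    IsFinGen D (radDiffSpan D (insert a I)) := by
  by_contra h
  have hle : I ≤ radDiffSpan D (insert a I) := fun x hx => subset_radDiffSpan _ (Or.inr hx)
  exact ha (hI.2 ⟨isRadDiff_radDiffSpan _, h⟩ hle (subset_radDiffSpan _ (Or.inl rfl)))

theorem isPrime_of_maximal (hI : Maximal (fun I => IsRadDiff D I ∧ ¬ IsFinGen D I) I) :
    I.IsPrime := by
  constructor
  · intro h
    refine hI.1.2 ⟨{1}, Set.finite_singleton 1, ?_⟩
    rw [h, eq_comm, Ideal.eq_top_iff_one]
    exact subset_radDiffSpan _ rfl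
  · intro a b hab
    by_contra! h
    obtain ⟨F, hFI, hF, hIF⟩ := (isFinGen_insert_of_maximal hI h.1).exists_finite_insert
    obtain ⟨G, hGI, hG, hIG⟩ := (isFinGen_insert_of_maximal hI h.2).exists_finite_insert
    have hfin : (Set.image2 (· * ·) (insert a F) (insert b G)).Finite :=
      (hF.insert a).image2 _ (hG.insert b)
    refine hI.1.2 ⟨_, hfin, le_antisymm (fun x hx => ?_) (radDiffSpan_le hI.1.1 ?_)⟩
    · exact (isRadDiff_radDiffSpan _).mem_of_sq_mem (mul_mem_of_mem_radDiffSpan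
        (isRadDiff_radDiffSpan _)
        (fun s hs t ht => subset_radDiffSpan _ (Set.mem_image2_of_mem hs ht)) (hIF hx) (hIG hx))
    · rintro _ ⟨s, rfl | hs, t, rfl | ht, rfl⟩
      · exact hab
      · exact I.mul_mem_left _ (hGI ht)
      · exact I.mul_mem_right _ (hFI hs)
      · exact I.mul_mem_right _ (hFI hs)

/-- If every prime radical differential ideal is finitely generated up to inverting one element
outside of it, then every radical differential ideal is finitely generated. -/
theorem isFinGen_of_forall_isPrime
    (h : ∀ I : Ideal A, I.IsPrime → IsRadDiff D I →
      ∃ F ⊆ (I : Set A), F.Finite ∧ ∃ H ∉ I, ∀ x ∈ I, H * x ∈ radDiffSpan D F)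
    (hI : IsRadDiff D I) : IsFinGen D I := by
  by_contra hfg
  obtain ⟨P, hP⟩ := exists_maximal_not_isFinGen hI hfg
  obtain ⟨F, hFP, hF, H, hH, hHF⟩ := h P (isPrime_of_maximal hP) hP.1.1
  obtain ⟨G, hGP, hG, hPG⟩ := (isFinGen_insert_of_maximal hP hH).exists_finite_insert
  refine hP.1.2 ⟨F ∪ G, hF.union hG, le_antisymm (fun x hx => ?_)
    (radDiffSpan_le hP.1.1 (Set.union_subset hFP hGP))⟩
  have hK := isRadDiff_radDiffSpan (D := D) (F ∪ G)
  refine hK.mem_of_sq_mem (mul_mem_of_mem_radDiffSpan (S := {x}) (T := insert H G) hK ?_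
    (subset_radDiffSpan _ rfl) (hPG hx))
  rintro _ rfl t (rfl | ht)
  · rw [mul_comm]
    exact radDiffSpan_mono Set.subset_union_left (hHF _ hx)
  · exact Ideal.mul_mem_left _ _ (subset_radDiffSpan _ (Or.inr ht))

theorem stabilizes_of_isFinGen (h : ∀ I : Ideal A, IsRadDiff D I → IsFinGen D I)
    {I : ℕ → Ideal A} (hmono : Monotone I) (hI : ∀ s, IsRadDiff D (I s)) :
    ∃ n : ℕ, ∀ s, n ≤ s → I s = I n := by
  have hmem : ∀ x : A, x ∈ iSup I ↔ ∃ s, x ∈ I s := fun x =>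
    Submodule.mem_iSup_of_directed _ hmono.directed_le
  have hsup : IsRadDiff D (iSup I) :=
    { isRadical := by
        rintro x ⟨n, hn⟩
        obtain ⟨s, hx⟩ := (hmem _).1 hn
        exact (hmem _).2 ⟨s, (hI s).isRadical ⟨n, hx⟩⟩
      der_mem := by
        intro x hx
        obtain ⟨s, hx⟩ := (hmem _).1 hx
        exact (hmem _).2 ⟨s, (hI s).der_mem x hx⟩ }
  obtain ⟨F, hF, hFI⟩ := h _ hsup
  choose! s hs using fun x (hx : x ∈ F) =>
    (hmem x).1 (hFI ▸ subset_radDiffSpan (D := D) F hx)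
  obtain ⟨n, hn⟩ := (hF.image s).bddAbove
  have hle : iSup I ≤ I n := by
    rw [hFI]
    exact radDiffSpan_le (hI n) fun x hx => hmono (hn (Set.mem_image_of_mem s hx)) (hs x hx)
  exact ⟨n, fun m hm => le_antisymm ((le_iSup I m).trans hle) (hmono hm)⟩

end RadicalDifferentialIdeal

section Reduction

open Polynomial (aeval natDegree)

variable {N : ℕ}

/-- Polynomials in the variables that are lexicographically smaller than `v`. -/
abbrev lowerVars (v : Fin N × ℕ) : Subalgebra ℂ (B N) :=
  MvPolynomial.supported ℂ {w | toLex w < toLex v}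

theorem lowerVars_mono {v w : Fin N × ℕ} (h : toLex v ≤ toLex w) :
    lowerVars v ≤ lowerVars w :=
  MvPolynomial.supported_mono fun _ hu => lt_of_lt_of_le hu h

theorem X_mem_lowerVars {v w : Fin N × ℕ} (h : toLex v < toLex w) :
    (MvPolynomial.X v : B N) ∈ lowerVars w :=
  MvPolynomial.X_mem_supported.2 h

theorem toLex_lt_succ (i : Fin N) (α : ℕ) : toLex (i, α) < toLex (i, α + 1) := by
  simp [Prod.Lex.toLex_lt_toLex]

theorem derB_mem_lowerVars {i : Fin N} {α : ℕ} {a : B N} (ha : a ∈ lowerVars (i, α)) :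
    derB N a ∈ lowerVars (i, α + 1) := by
  induction ha using Algebra.adjoin_induction with
  | mem x hx =>
    obtain ⟨w, hw, rfl⟩ := hx
    rw [derB, MvPolynomial.mkDerivation_X]
    apply X_mem_lowerVars
    simp only [Set.mem_ofPred_eq, Prod.Lex.toLex_lt_toLex] at hw ⊢
    grind
  | algebraMap r => simp
  | add x y _ _ hx hy => rw [map_add]; exact add_mem hx hy
  | mul x y hx hy hx' hy' =>
    have hle := lowerVars_mono (toLex_lt_succ i α).le
    rw [Derivation.leibniz]
    exact add_mem (mul_mem (hle hx) hy') (mul_mem (hle hy) hx')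

theorem exists_aeval_eq {v : Fin N × ℕ} {g : B N}
    (hg : g ∈ MvPolynomial.supported ℂ {w | toLex w ≤ toLex v}) :
    ∃ p : Polynomial (lowerVars v), aeval (MvPolynomial.X v : B N) p = g := by
  have h : MvPolynomial.supported ℂ {w | toLex w ≤ toLex v} ≤
      ((aeval (R := lowerVars v) (MvPolynomial.X v : B N)).restrictScalars ℂ).range := by
    rw [MvPolynomial.supported_eq_adjoin_X, Algebra.adjoin_le_iff]
    rintro _ ⟨w, hw, rfl⟩
    rcases lt_or_eq_of_le (show toLex w ≤ toLex v from hw) with h | h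
    · exact ⟨Polynomial.C ⟨_, X_mem_lowerVars h⟩, by simp⟩
    · obtain rfl : w = v := toLex.injective h
      exact ⟨Polynomial.X, by simp⟩
  exact h hg

/-- `p`, evaluated at the variable `v`, is an element of `I` whose initial is not in `I`. -/
def IsLead (I : Ideal (B N)) (v : Fin N × ℕ) (p : Polynomial (lowerVars v)) : Prop :=
  aeval (MvPolynomial.X v : B N) p ∈ I ∧ (p.leadingCoeff : B N) ∉ I

theorem IsLead.natDegree_pos {I : Ideal (B N)} {v : Fin N × ℕ} {p : Polynomial (lowerVars v)}
    (hp : IsLead I v p) : 0 < p.natDegree := by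
  by_contra! h
  obtain ⟨c, rfl⟩ := Polynomial.natDegree_eq_zero.1 (Nat.le_zero.1 h)
  obtain ⟨h1, h2⟩ := hp
  rw [Polynomial.aeval_C] at h1
  rw [Polynomial.leadingCoeff_C] at h2
  exact h2 h1

/-- `p` has minimal degree among the polynomials with `IsLead I v`. -/
def IsMinLead (I : Ideal (B N)) (v : Fin N × ℕ) (p : Polynomial (lowerVars v)) : Prop :=
  IsLead I v p ∧ ∀ q, IsLead I v q → p.natDegree ≤ q.natDegree

theorem degree_pseudoRemainder_lt {R : Type*} [CommRing R] [IsDomain R] {p g : Polynomial R}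
    (hp0 : p ≠ 0) (hg0 : g ≠ 0) (hle : p.natDegree ≤ g.natDegree) :
    (Polynomial.C p.leadingCoeff * g - Polynomial.C g.leadingCoeff *
      Polynomial.X ^ (g.natDegree - p.natDegree) * p).degree < g.degree := by
  have hd1 : (Polynomial.C p.leadingCoeff * g).degree = g.degree :=
    Polynomial.degree_C_mul (by simpa using hp0)
  have hd2 : (Polynomial.C g.leadingCoeff * Polynomial.X ^ (g.natDegree - p.natDegree) *
      p).degree = g.degree := by
    rw [mul_assoc, Polynomial.degree_C_mul (by simpa using hg0), Polynomial.degree_mul,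
      Polynomial.degree_X_pow, Polynomial.degree_eq_natDegree hp0,
      Polynomial.degree_eq_natDegree hg0]
    exact_mod_cast Nat.sub_add_cancel hle
  rw [← hd1]
  refine Polynomial.degree_sub_lt_left (hd1.trans hd2.symm) ?_ ?_
  · exact mul_ne_zero (by simpa using hp0) hg0
  · rw [Polynomial.leadingCoeff_mul, Polynomial.leadingCoeff_mul, Polynomial.leadingCoeff_mul,
      Polynomial.leadingCoeff_C, Polynomial.leadingCoeff_C, Polynomial.leadingCoeff_X_pow,
      mul_one, mul_comm]

theorem aeval_C_mul_sub {R S : Type*} [CommRing R] [CommRing S] [Algebra R S] (x : S) (a : R)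
    (p q g : Polynomial R) :
    aeval x (Polynomial.C a * g - q * p) =
      algebraMap R S a * aeval x g - aeval x q * aeval x p := by
  rw [map_sub, map_mul, map_mul, Polynomial.aeval_C]

theorem aeval_mem_of_reduction {I J : Ideal (B N)} {v : Fin N × ℕ}
    (hlow : ∀ c ∈ lowerVars v, c ∈ I → c ∈ J)
    (h : (∃ p, IsLead I v p) → ∃ p, IsMinLead I v p ∧ aeval (MvPolynomial.X v : B N) p ∈ J ∧
      ∀ x, (p.leadingCoeff : B N) * x ∈ J → x ∈ J)
    (n : ℕ) : ∀ g : Polynomial (lowerVars v), g.degree < n →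
      aeval (MvPolynomial.X v : B N) g ∈ I → aeval (MvPolynomial.X v : B N) g ∈ J := by
  induction n with
  | zero =>
    intro g hg _
    have : g = 0 := by
      rw [← Polynomial.degree_eq_bot]
      simpa using hg
    simp [this]
  | succ n ih =>
    intro g hg hgI
    by_cases hg0 : g = 0
    · simp [hg0]
    have hlt : ∀ r : Polynomial (lowerVars v), r.degree < g.degree → r.degree < n := fun r hr =>
      lt_of_lt_of_le hr (Polynomial.degree_le_of_natDegree_le
        (Nat.lt_succ_iff.1 ((Polynomial.natDegree_lt_iff_degree_lt hg0).2 hg)))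
    by_cases hlc : (g.leadingCoeff : B N) ∈ I
    · have hsum := congrArg (aeval (MvPolynomial.X v : B N))
        g.eraseLead_add_monomial_natDegree_leadingCoeff
      rw [map_add, Polynomial.aeval_monomial] at hsum
      have hcI : algebraMap (lowerVars v) (B N) g.leadingCoeff ∈ I := hlc
      have hcJ : algebraMap (lowerVars v) (B N) g.leadingCoeff ∈ J := hlow _ g.leadingCoeff.2 hlc
      have h1 : aeval (MvPolynomial.X v : B N) g.eraseLead ∈ I := by
        rw [← eq_sub_iff_add_eq] at hsum
        rw [hsum]
        exact I.sub_mem hgI (I.mul_mem_right _ hcI)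
      rw [← hsum]
      exact J.add_mem (ih _ (hlt _ (Polynomial.degree_eraseLead_lt hg0)) h1)
        (J.mul_mem_right _ hcJ)
    · obtain ⟨p, ⟨hp, hmin⟩, hpJ, hreg⟩ := h ⟨g, hgI, hlc⟩
      have hle : p.natDegree ≤ g.natDegree := hmin g ⟨hgI, hlc⟩
      have hp0 : p ≠ 0 := by
        rintro rfl
        exact hp.2 (by simp)
      have hdeg := degree_pseudoRemainder_lt hp0 hg0 hle
      have hr := ih _ (hlt _ hdeg)
      rw [aeval_C_mul_sub] at hr
      have hrJ := hr (I.sub_mem (I.mul_mem_left _ hgI) (I.mul_mem_left _ hp.1))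
      exact hreg _ ((Submodule.sub_mem_iff_left J (J.mul_mem_left _ hpJ)).1 hrJ)

theorem le_of_reduction {I J : Ideal (B N)} (hI : I ≠ ⊤)
    (h : ∀ v, (∃ p, IsLead I v p) → ∃ p, IsMinLead I v p ∧
      aeval (MvPolynomial.X v : B N) p ∈ J ∧ ∀ x, (p.leadingCoeff : B N) * x ∈ J → x ∈ J) :
    I ≤ J := by
  have hfin : ∀ (V : Set (Fin N × ℕ)),
      (∀ v ∈ V, ∀ g ∈ MvPolynomial.supported ℂ {w | toLex w ≤ toLex v}, g ∈ I → g ∈ J) →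
      ∀ g ∈ MvPolynomial.supported ℂ V, g ∈ I → g ∈ J := by
    intro V hV g hg hgI
    rw [MvPolynomial.mem_supported] at hg
    rcases g.vars.eq_empty_or_nonempty with h0 | h0
    · have : g ∈ MvPolynomial.supported ℂ (∅ : Set (Fin N × ℕ)) := by
        rw [MvPolynomial.mem_supported, h0]
        simp
      rw [MvPolynomial.supported_empty, Algebra.mem_bot] at this
      obtain ⟨c, rfl⟩ := this
      by_cases hc : c = 0
      · simp [hc]
      · exact absurd (I.eq_top_of_isUnit_mem hgI ((IsUnit.mk0 c hc).map _)) hI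
    · obtain ⟨u, hu, hmax⟩ := g.vars.exists_max_image toLex h0
      exact hV u (hg hu) g (MvPolynomial.mem_supported.2 fun w hw => hmax w hw) hgI
  have key : ∀ v : Fin N ×ₗ ℕ, ∀ g ∈ MvPolynomial.supported ℂ {w | toLex w ≤ v},
      g ∈ I → g ∈ J := by
    intro v
    induction v using WellFoundedLT.induction with
    | ind v ih =>
      intro g hg hgI
      obtain ⟨p, rfl⟩ := exists_aeval_eq (v := ofLex v) hg
      refine aeval_mem_of_reduction ?_ (h _) (p.natDegree + 1) p ?_ hgI
      · exact hfin _ fun w hw => ih (toLex w) hw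
      · exact lt_of_le_of_lt Polynomial.degree_le_natDegree
          (by exact_mod_cast Nat.lt_succ_self _)
  intro g hg
  exact hfin Set.univ (fun v _ => key (toLex v)) g (by simp) hg

theorem exists_derB_aeval_eq {i : Fin N} {α : ℕ} (p : Polynomial (lowerVars (i, α))) :
    ∃ T ∈ lowerVars (i, α + 1), derB N (aeval (MvPolynomial.X (i, α) : B N) p) =
      aeval (MvPolynomial.X (i, α) : B N) p.derivative * MvPolynomial.X (i, α + 1) + T := by
  induction p using Polynomial.induction_on' with
  | add p q hp hq =>
    obtain ⟨T, hT, h1⟩ := hp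
    obtain ⟨U, hU, h2⟩ := hq
    refine ⟨T + U, add_mem hT hU, ?_⟩
    rw [map_add, map_add, h1, h2, Polynomial.derivative_add, map_add]
    ring
  | monomial n a =>
    refine ⟨MvPolynomial.X (i, α) ^ n * derB N a,
      mul_mem (pow_mem (X_mem_lowerVars (toLex_lt_succ i α)) n) (derB_mem_lowerVars a.2), ?_⟩
    have hX : derB N (MvPolynomial.X (i, α)) = MvPolynomial.X (i, α + 1) := by
      rw [derB, MvPolynomial.mkDerivation_X]
    have ha : algebraMap (lowerVars (i, α)) (B N) a = a := rfl
    rw [Polynomial.derivative_monomial, Polynomial.aeval_monomial, Polynomial.aeval_monomial,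
      Derivation.leibniz, Derivation.leibniz_pow, hX, map_mul, ha, map_natCast]
    simp only [smul_eq_mul, nsmul_eq_mul]
    ring

theorem aeval_mem_lowerVars {i : Fin N} {α : ℕ} (p : Polynomial (lowerVars (i, α))) :
    aeval (MvPolynomial.X (i, α) : B N) p ∈ lowerVars (i, α + 1) := by
  induction p using Polynomial.induction_on' with
  | add p q hp hq => rw [map_add]; exact add_mem hp hq
  | monomial n a =>
    rw [Polynomial.aeval_monomial]
    exact mul_mem (lowerVars_mono (toLex_lt_succ i α).le a.2)
      (pow_mem (X_mem_lowerVars (toLex_lt_succ i α)) n)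

theorem exists_iterate_derB_aeval_eq {i : Fin N} {α : ℕ} (p : Polynomial (lowerVars (i, α)))
    (n : ℕ) :
    ∃ T ∈ lowerVars (i, α + n + 1), (derB N)^[n + 1] (aeval (MvPolynomial.X (i, α) : B N) p) =
      aeval (MvPolynomial.X (i, α) : B N) p.derivative * MvPolynomial.X (i, α + n + 1) + T := by
  induction n with
  | zero => simpa using exists_derB_aeval_eq p
  | succ n ih =>
    obtain ⟨T, hT, h⟩ := ih
    have hS := lowerVars_mono (w := (i, α + n + 1)) (by simp [Prod.Lex.toLex_le_toLex])
      (aeval_mem_lowerVars p.derivative)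
    refine ⟨MvPolynomial.X (i, α + n + 1) *
      derB N (aeval (MvPolynomial.X (i, α) : B N) p.derivative) + derB N T,
      add_mem (mul_mem (X_mem_lowerVars (toLex_lt_succ i _)) (derB_mem_lowerVars hS))
        (derB_mem_lowerVars hT), ?_⟩
    have hX : derB N (MvPolynomial.X (i, α + n + 1)) = MvPolynomial.X (i, α + n + 1 + 1) := by
      rw [derB, MvPolynomial.mkDerivation_X]
    rw [Function.iterate_succ_apply', h, map_add, Derivation.leibniz, hX]
    simp only [smul_eq_mul, ← add_assoc]

theorem IsMinLead.aeval_derivative_notMem {I : Ideal (B N)} (hI : I.IsPrime) {v : Fin N × ℕ}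
    {p : Polynomial (lowerVars v)} (hp : IsMinLead I v p) :
    aeval (MvPolynomial.X v : B N) p.derivative ∉ I := by
  intro h
  have hpos := hp.1.natDegree_pos
  have hlt := Polynomial.natDegree_derivative_lt hpos.ne'
  refine absurd (hp.2 p.derivative ⟨h, fun hc => ?_⟩) (not_le.2 hlt)
  have hlc : p.derivative.leadingCoeff = p.leadingCoeff * (p.natDegree : lowerVars v) := by
    rw [Polynomial.leadingCoeff, Polynomial.natDegree_derivative, Polynomial.coeff_derivative,
      Nat.sub_add_cancel hpos, Polynomial.leadingCoeff]
    norm_cast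
    rw [Nat.sub_add_cancel hpos]
  rw [hlc] at hc
  push_cast at hc
  rcases hI.mem_or_mem hc with hc | hc
  · exact hp.1.2 hc
  · refine hI.ne_top (I.eq_top_of_isUnit_mem hc ?_)
    have : IsUnit ((p.natDegree : ℂ)) := IsUnit.mk0 _ (by exact_mod_cast hpos.ne')
    simpa using this.map (algebraMap ℂ (B N))

theorem exists_isMinLead {I : Ideal (B N)} {v : Fin N × ℕ} (h : ∃ p, IsLead I v p) :
    ∃ p, IsMinLead I v p := by
  obtain ⟨p, hp, hmin⟩ := exists_minimalFor_of_wellFoundedLT (IsLead I v) natDegree h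
  exact ⟨p, hp, fun q hq => by
    by_contra! hlt
    exact absurd (hmin hq hlt.le) (not_le.2 hlt)⟩

theorem exists_element_and_multiplier {I : Ideal (B N)} (hI : I.IsPrime)
    (hD : ∀ a ∈ I, derB N a ∈ I) (i : Fin N) :
    ∃ f ∈ I, ∃ h ∉ I, ∀ α, (∃ p, IsLead I (i, α) p) →
      ∃ p, IsMinLead I (i, α) p ∧ (p.leadingCoeff : B N) ∣ h ∧
        ∃ n, aeval (MvPolynomial.X (i, α) : B N) p = (derB N)^[n] f := by
  classical
  by_cases hex : ∃ α, ∃ p, IsLead I (i, α) p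
  swap
  · exact ⟨0, I.zero_mem, 1, fun h1 => hI.ne_top (I.eq_top_iff_one.2 h1),
      fun α h => absurd ⟨α, h⟩ hex⟩
  obtain ⟨p, hp⟩ := exists_isMinLead (Nat.find_spec hex)
  have hmin : ∀ α, (∃ p, IsLead I (i, α) p) → Nat.find hex ≤ α := fun α h =>
    Nat.find_min' hex h
  generalize Nat.find hex = β at p hp hmin
  have hS := hp.aeval_derivative_notMem hI
  refine ⟨aeval (MvPolynomial.X (i, β) : B N) p, hp.1.1, (p.leadingCoeff : B N) *
    aeval (MvPolynomial.X (i, β) : B N) p.derivative, fun h => ?_, fun α h => ?_⟩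
  · exact (hI.mem_or_mem h).elim hp.1.2 hS
  obtain ⟨n, rfl⟩ := Nat.exists_eq_add_of_le (hmin α h)
  cases n with
  | zero => exact ⟨p, hp, dvd_mul_right _ _, 0, rfl⟩
  | succ n =>
    obtain ⟨T, hT, hder⟩ := exists_iterate_derB_aeval_eq p n
    have hSmem : aeval (MvPolynomial.X (i, β) : B N) p.derivative ∈ lowerVars (i, β + n + 1) :=
      lowerVars_mono (by simp [Prod.Lex.toLex_le_toLex]) (aeval_mem_lowerVars p.derivative)
    have hmem : ∀ m, (derB N)^[m] (aeval (MvPolynomial.X (i, β) : B N) p) ∈ I := by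
      intro m
      induction m with
      | zero => exact hp.1.1
      | succ m ih => rw [Function.iterate_succ_apply']; exact hD _ ih
    have hS0 : (⟨_, hSmem⟩ : lowerVars (i, β + n + 1)) ≠ 0 := by
      intro h0
      apply hS
      have h1 : aeval (MvPolynomial.X (i, β) : B N) p.derivative = 0 := congrArg Subtype.val h0
      rw [h1]
      exact I.zero_mem
    have hev : aeval (MvPolynomial.X (i, β + n + 1) : B N)
        (Polynomial.C (⟨_, hSmem⟩ : lowerVars (i, β + n + 1)) * Polynomial.X +
          Polynomial.C ⟨T, hT⟩) =
        (derB N)^[n + 1] (aeval (MvPolynomial.X (i, β) : B N) p) := by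
      rw [hder, map_add, map_mul, Polynomial.aeval_C, Polynomial.aeval_C, Polynomial.aeval_X]
      rfl
    have hlc := Polynomial.leadingCoeff_linear (b := ⟨T, hT⟩) hS0
    refine ⟨_, ⟨⟨hev ▸ hmem (n + 1), ?_⟩, fun q hq => ?_⟩, ?_, n + 1, hev⟩
    · rw [hlc]
      exact hS
    · rw [Polynomial.natDegree_linear hS0]
      exact hq.natDegree_pos
    · rw [hlc]
      exact dvd_mul_left _ _

theorem exists_finite_multiplier {I : Ideal (B N)} (hI : I.IsPrime)
    (hD : IsRadDiff (derB N) I) :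
    ∃ F ⊆ (I : Set (B N)), F.Finite ∧ ∃ H ∉ I, ∀ x ∈ I, H * x ∈ radDiffSpan (derB N) F := by
  choose f hf h hh hred using exists_element_and_multiplier hI hD.der_mem
  have hK := isRadDiff_radDiffSpan (D := derB N) (Set.range f)
  refine ⟨Set.range f, Set.range_subset_iff.2 hf, Set.finite_range f, ∏ i, h i, ?_, ?_⟩
  · rw [hI.prod_mem_iff]
    simpa using hh
  have hle : I ≤ colonElem (radDiffSpan (derB N) (Set.range f)) (∏ i, h i) := by
    refine le_of_reduction hI.ne_top fun ⟨i, α⟩ hex => ?_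
    obtain ⟨p, hp, hdvd, n, hn⟩ := hred i α hex
    refine ⟨p, hp, ?_, fun x hx => ?_⟩
    · rw [hn]
      refine mem_colonElem.2 (Ideal.mul_mem_left _ _ ?_)
      clear hn
      induction n with
      | zero => exact subset_radDiffSpan _ (Set.mem_range_self i)
      | succ n ih => rw [Function.iterate_succ_apply']; exact hK.der_mem _ ih
    · rw [mem_colonElem] at hx ⊢
      obtain ⟨c, hc⟩ := hdvd.trans (Finset.dvd_prod_of_mem h (Finset.mem_univ i))
      apply hK.mem_of_sq_mem
      have : (∏ i, h i) * x * ((∏ i, h i) * x) =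
          c * x * ((∏ i, h i) * ((p.leadingCoeff : B N) * x)) := by
        nth_rewrite 2 [hc]
        ring
      rw [this]
      exact Ideal.mul_mem_left _ _ hx
  exact fun x hx => hle hx

end Reduction

/-- Ritt–Raudenbush basis theorem: every ascending chain
`I_0 ⊆ I_1 ⊆ I_2 ⊆ ⋯` of radical differential ideals of `B` eventually stabilizes. -/
theorem stmt_12 (N : ℕ) (hN : 1 ≤ N)
    (I : ℕ → Ideal (B N))
    (hchain : ∀ s, I s ≤ I (s + 1))
    (hdiff : ∀ s, ∀ a ∈ I s, derB N a ∈ I s)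
    (hrad : ∀ s, (I s).IsRadical) :
    ∃ n : ℕ, ∀ s, n ≤ s → I s = I n := by
  have hI : ∀ s, IsRadDiff (derB N) (I s) := fun s => ⟨hrad s, hdiff s⟩
  exact stabilizes_of_isFinGen
    (fun _ => isFinGen_of_forall_isPrime fun _ => exists_finite_multiplier)
    (monotone_nat_of_le_succ hchain) hI

end
end

section
/- (The identity T₄ holds in every differential algebra with one derivation.) For all elements x₁, x₂, x₃, x₄, x₅ ∈ R, the alternating sum over the symmetric group S₄ vanishes: Σ_{β ∈ S₄} sgn(β) · ⁅x_{β(1)}, ⁅x_{β(2)}, ⁅x_{β(3)}, ⁅x_{β(4)}, x₅⁆⁆⁆⁆ = 0, where the nested brackets are the Wronskian bracket ⁅a,b⁆ = a·∂(b) − ∂(a)·b. -/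
/-- Expansion of an alternating sum over the permutations of four letters. -/
theorem sum_sign_smul_perm_fin_four {M : Type*} [AddCommGroup M]
    (F : Fin 4 → Fin 4 → Fin 4 → Fin 4 → M) :
    ∑ β : Equiv.Perm (Fin 4), (Equiv.Perm.sign β : ℤ) • F (β 0) (β 1) (β 2) (β 3) =
      F 0 1 2 3 - F 0 1 3 2 - F 0 2 1 3 + F 0 2 3 1 +
      F 0 3 1 2 - F 0 3 2 1 - F 1 0 2 3 + F 1 0 3 2 +
      F 1 2 0 3 - F 1 2 3 0 - F 1 3 0 2 + F 1 3 2 0 +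
      F 2 0 1 3 - F 2 0 3 1 - F 2 1 0 3 + F 2 1 3 0 +
      F 2 3 0 1 - F 2 3 1 0 - F 3 0 1 2 + F 3 0 2 1 +
      F 3 1 0 2 - F 3 1 2 0 - F 3 2 0 1 + F 3 2 1 0 := by
  change ∑ β : Equiv.Perm (Fin 4), (Equiv.Perm.sign β : ℤ) •
    F (β 0) (β (Fin.succ 0)) (β (Fin.succ (Fin.succ 0))) (β (Fin.succ (Fin.succ (Fin.succ 0)))) = _
  simp only [Finset.univ_perm_fin_succ, Finset.sum_map, Equiv.coe_toEmbedding,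
    Fintype.sum_prod_type, Fin.sum_univ_succ, Finset.univ_unique, Finset.sum_singleton,
    Equiv.Perm.decomposeFin.symm_sign, Equiv.Perm.decomposeFin_symm_apply_zero,
    Equiv.Perm.decomposeFin_symm_apply_succ]
  simp +decide [Equiv.swap_apply_def]
  abel

/-- the identity `T₄` holds in every commutative algebra with one derivation:
for a commutative ring `R` with a derivation `∂` and the Wronskian bracket
`⁅a,b⁆ = a·∂(b) − ∂(a)·b`, the alternating sum over `S₄` of the nested brackets
`⁅x_{β(1)}, ⁅x_{β(2)}, ⁅x_{β(3)}, ⁅x_{β(4)}, x₅⁆⁆⁆⁆` vanishes. -/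
theorem stmt_16 {R : Type*} [CommRing R] (D : R → R)
    (hadd : ∀ a b : R, D (a + b) = D a + D b)
    (hleib : ∀ a b : R, D (a * b) = a * D b + D a * b)
    (br : R → R → R) (hbr : ∀ a b : R, br a b = a * D b - D a * b)
    (x : Fin 4 → R) (x₅ : R) :
    ∑ β : Equiv.Perm (Fin 4), (Equiv.Perm.sign β : ℤ) •
      br (x (β 0)) (br (x (β 1)) (br (x (β 2)) (br (x (β 3)) x₅))) = 0 := by
  have hsub (a b : R) : D (a - b) = D a - D b := by
    rw [eq_sub_iff_add_eq, ← hadd, sub_add_cancel]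
  have br_sub (a b c : R) : br a (b - c) = br a b - br a c := by
    simp only [hbr, hsub]; ring
  have jacobi (a b y : R) : br a (br b y) - br b (br a y) = br (br a b) y := by
    simp only [hbr, hsub, hleib]; ring
  have alternating_pairs (a b c d y : R) :
      br (br a b) (br (br c d) y) - br (br a c) (br (br b d) y) +
      br (br a d) (br (br b c) y) + br (br b c) (br (br a d) y) -
      br (br b d) (br (br a c) y) + br (br c d) (br (br a b) y) = 0 := by
    simp only [hbr, hsub, hadd, hleib]; ring
  rw [sum_sign_smul_perm_fin_four fun i j k l => br (x i) (br (x j) (br (x k) (br (x l) x₅)))]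
  rw [← alternating_pairs (x 0) (x 1) (x 2) (x 3) x₅]
  simp only [← jacobi, br_sub]
  abel
end
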